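/- arXiv:math/9501224 — 2 statements merged into one kernel-verified Lean document; each statement's English description precedes it below -/
import Mathlib

section
/- Let n ≥ 1, let a₀, a₁, …, aₙ be independent standard normal real random variables, and let p(x) = a₀ + a₁x + ⋯ + aₙxⁿ. For every measurable set I ⊆ ℝ, the expected number of zeros of p lying in I equals ∫_I ρₙ(t) dt, where ρₙ(t) = (1/π) √( 1/(t²−1)² − (n+1)²·t^(2n)/(t^(2n+2)−1)² ). That is, ρₙ is the density of real zeros of the random polynomial p. -/
open MeasureTheory ProbabilityTheory Real Set
open scoped ENNReal NNReal

theorem coe_encard_iUnion_of_pairwise_disjoint {α : Type*} {P : ℕ → Set α}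
    (hP : Pairwise (Function.onFun Disjoint P)) :
    ((⋃ k, P k).encard : ℝ≥0∞) = ∑' k, ((P k).encard : ℝ≥0∞) := by
  let _ : MeasurableSpace α := ⊤
  simp_rw [← Measure.count_apply (s := _) MeasurableSpace.measurableSet_top]
  exact measure_iUnion hP fun _ => MeasurableSpace.measurableSet_top

theorem Set.InjOn.coe_encard_fiber {α β : Type*} {f : α → β} {s : Set α} (hf : InjOn f s) (y : β) :
    ({x ∈ s | f x = y}.encard : ℝ≥0∞) = (f '' s).indicator 1 y := by
  by_cases hy : y ∈ f '' s
  · obtain ⟨x, hx, rfl⟩ := hy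
    have : {z ∈ s | f z = f x} = {x} := by
      ext z
      exact ⟨fun hz => hf hz.1 hx hz.2, by rintro rfl; exact ⟨hx, rfl⟩⟩
    simp [this, mem_image_of_mem f hx]
  · have : {x ∈ s | f x = y} = ∅ := by
      ext x
      simp only [mem_ofPred_eq, mem_empty_iff_false, iff_false]
      rintro ⟨hx, rfl⟩
      exact hy (mem_image_of_mem f hx)
    simp [this, hy]

section AreaFormula

variable {E : Type*} [NormedAddCommGroup E] [NormedSpace ℝ E] [FiniteDimensional ℝ E]

theorem exists_pos_injOn_of_approximatesLinearOn (A : E →L[ℝ] E) :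
    ∃ c : ℝ≥0, c ≠ 0 ∧ (A.det ≠ 0 →
      ∀ (f : E → E) (u : Set E), ApproximatesLinearOn f A u c → InjOn f u) := by
  by_cases hA : A.det = 0
  · exact ⟨1, one_ne_zero, fun h => (h hA).elim⟩
  let B := A.toContinuousLinearEquivOfDetNeZero hA
  have hB : (B : E →L[ℝ] E) = A := A.coe_toContinuousLinearEquivOfDetNeZero hA
  rcases B.subsingleton_or_nnnorm_symm_pos with h | h
  · refine ⟨1, one_ne_zero, fun _ f u hf => ?_⟩
    rw [← hB] at hf
    exact hf.injOn (Or.inl h)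
  · refine ⟨‖(B.symm : E →L[ℝ] E)‖₊⁻¹ / 2, by positivity, fun _ f u hf => ?_⟩
    rw [← hB] at hf
    exact hf.injOn (Or.inr (NNReal.half_lt_self (by positivity)))

variable [MeasurableSpace E] [BorelSpace E] (μ : Measure E) [μ.IsAddHaarMeasure]
  {f : E → E} {f' : E → E →L[ℝ] E} {s : Set E}

theorem exists_seq_injOn_coe_encard_fiber_ae_eq (hs : MeasurableSet s)
    (hdet : MeasurableSet {x | (f' x).det = 0}) (hf : ∀ x ∈ s, HasFDerivWithinAt f (f' x) s x) :
    ∃ P : ℕ → Set E, Pairwise (Function.onFun Disjoint P) ∧ (∀ k, MeasurableSet (P k)) ∧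
      (⋃ k, P k) = s \ {x | (f' x).det = 0} ∧ (∀ k, InjOn f (P k)) ∧
      (fun y => ({x ∈ s | f x = y}.encard : ℝ≥0∞)) =ᵐ[μ]
        fun y => ∑' k, (f '' P k).indicator 1 y := by
  choose r hr0 hr using exists_pos_injOn_of_approximatesLinearOn (E := E)
  set N := s \ {x | (f' x).det = 0} with hN
  obtain ⟨t, A, tdisj, tmeas, tcov, tapp, hA⟩ :=
    exists_partition_approximatesLinearOn_of_hasFDerivWithinAt f N f'
      (fun x hx => (hf x hx.1).mono sdiff_subset) r hr0
  have hinj : ∀ k, InjOn f (N ∩ t k) := by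
    intro k
    rcases N.eq_empty_or_nonempty with h | h
    · simp [h]
    · obtain ⟨y, hy, hAy⟩ := hA h k
      exact hr (A k) (by rw [hAy]; exact hy.2) f _ (tapp k)
  have hdisj : Pairwise (Function.onFun Disjoint fun k => N ∩ t k) := fun i j hij =>
    (tdisj hij).mono inter_subset_right inter_subset_right
  have hU : (⋃ k, N ∩ t k) = N := by
    rw [← inter_iUnion, inter_eq_left]
    exact tcov
  refine ⟨fun k => N ∩ t k, hdisj, fun k => (hs.diff hdet).inter (tmeas k), hU, hinj, ?_⟩
  have hnull : μ (f '' (s ∩ {x | (f' x).det = 0})) = 0 :=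
    addHaar_image_eq_zero_of_det_fderivWithin_eq_zero μ
      (fun x hx => (hf x hx.1).mono inter_subset_left) fun x hx => hx.2
  filter_upwards [measure_eq_zero_iff_ae_notMem.1 hnull] with y hy
  simp_rw [← (hinj _).coe_encard_fiber]
  rw [← coe_encard_iUnion_of_pairwise_disjoint]
  · congr 2
    ext x
    rw [← ofPred_exists]
    simp only [mem_ofPred_eq]
    rw [exists_and_right, ← mem_iUnion, hU]
    constructor
    · rintro ⟨hx, rfl⟩
      exact ⟨⟨hx, fun h => hy ⟨x, ⟨hx, h⟩, rfl⟩⟩, rfl⟩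
    · rintro ⟨hx, rfl⟩
      exact ⟨hx.1, rfl⟩
  · exact fun i j hij => (hdisj hij).mono (fun _ h => h.1) fun _ h => h.1

theorem aemeasurable_coe_encard_fiber (hs : MeasurableSet s)
    (hdet : MeasurableSet {x | (f' x).det = 0}) (hf : ∀ x ∈ s, HasFDerivWithinAt f (f' x) s x) :
    AEMeasurable (fun y => ({x ∈ s | f x = y}.encard : ℝ≥0∞)) μ := by
  obtain ⟨P, -, hPm, hPU, hPi, hP⟩ := exists_seq_injOn_coe_encard_fiber_ae_eq μ hs hdet hf
  have hPs : ∀ k, P k ⊆ s := fun k => ((subset_iUnion P k).trans hPU.subset).trans sdiff_subset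
  refine AEMeasurable.congr (Measurable.aemeasurable (Measurable.tsum fun k => ?_)) hP.symm
  exact measurable_one.indicator (measurable_image_of_fderivWithin (hPm k)
    (fun x hx => (hf x (hPs k hx)).mono (hPs k)) (hPi k))

/-- The **area formula** in equal dimensions, counting preimages with multiplicity. -/
theorem lintegral_coe_encard_fiber_mul (hs : MeasurableSet s)
    (hdet : MeasurableSet {x | (f' x).det = 0}) (hf : ∀ x ∈ s, HasFDerivWithinAt f (f' x) s x)
    {g : E → ℝ≥0∞} (hg : Measurable g) :
    ∫⁻ y, ({x ∈ s | f x = y}.encard : ℝ≥0∞) * g y ∂μ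
      = ∫⁻ x in s, ENNReal.ofReal |(f' x).det| * g (f x) ∂μ := by
  obtain ⟨P, hPd, hPm, hPU, hPi, hP⟩ := exists_seq_injOn_coe_encard_fiber_ae_eq μ hs hdet hf
  have hPs : ∀ k, P k ⊆ s := fun k => ((subset_iUnion P k).trans hPU.subset).trans sdiff_subset
  have hPf : ∀ k, ∀ x ∈ P k, HasFDerivWithinAt f (f' x) (P k) x := fun k x hx =>
    (hf x (hPs k hx)).mono (hPs k)
  have hPim : ∀ k, MeasurableSet (f '' P k) := fun k =>
    measurable_image_of_fderivWithin (hPm k) (hPf k) (hPi k)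
  have hind : ∀ k y, (f '' P k).indicator (1 : E → ℝ≥0∞) y * g y = (f '' P k).indicator g y := by
    intro k y
    by_cases hy : y ∈ f '' P k <;> simp [hy]
  calc ∫⁻ y, ({x ∈ s | f x = y}.encard : ℝ≥0∞) * g y ∂μ
      = ∫⁻ y, ∑' k, (f '' P k).indicator g y ∂μ := by
        refine lintegral_congr_ae ?_
        filter_upwards [hP] with y hy
        rw [hy, ← ENNReal.tsum_mul_right]
        simp_rw [hind]
    _ = ∑' k, ∫⁻ y in f '' P k, g y ∂μ := by
        rw [lintegral_tsum fun k => (hg.indicator (hPim k)).aemeasurable]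
        simp_rw [lintegral_indicator (hPim _)]
    _ = ∑' k, ∫⁻ x in P k, ENNReal.ofReal |(f' x).det| * g (f x) ∂μ := by
        congr with k
        exact lintegral_image_eq_lintegral_abs_det_fderiv_mul μ (hPm k) (hPf k) (hPi k) g
    _ = ∫⁻ x in s \ {x | (f' x).det = 0}, ENNReal.ofReal |(f' x).det| * g (f x) ∂μ := by
        rw [← hPU, lintegral_iUnion hPm hPd]
    _ = ∫⁻ x in s, ENNReal.ofReal |(f' x).det| * g (f x) ∂μ := by
        rw [← lintegral_inter_add_sdiff _ s hdet, setLIntegral_congr_fun (g := fun _ => 0)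
          (hs.inter hdet) (fun x hx => by simp [show (f' x).det = 0 from hx.2])]
        simp

end AreaFormula
theorem lintegral_ofReal_abs_gaussianReal (v : ℝ≥0) :
    ∫⁻ x, ENNReal.ofReal |x| ∂(gaussianReal 0 v) = ENNReal.ofReal √(2 * v / π) := by
  have key : ∫⁻ x, ENNReal.ofReal |x| ∂(gaussianReal 0 1) = ENNReal.ofReal √(2 / π) := by
    have h1 : ∫ x : ℝ, |x| ∂(gaussianReal 0 1) = √(2 / π) := by
      rw [integral_gaussianReal_eq_integral_smul one_ne_zero]
      have h2 : ∀ x : ℝ, gaussianPDFReal 0 1 x • |x|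
          = (fun y : ℝ => (√(2 * π))⁻¹ * (y * rexp (-(1 / 2) * y ^ 2))) |x| := by
        intro x
        simp only [gaussianPDFReal, smul_eq_mul, sq_abs]
        simp
        ring_nf
      simp_rw [h2]
      rw [integral_comp_abs (f := fun y : ℝ => (√(2 * π))⁻¹ * (y * rexp (-(1 / 2) * y ^ 2))),
        integral_const_mul]
      have h3 := integral_mul_cexp_neg_mul_sq (b := 1 / 2) (by norm_num)
      have h4 : ∫ y : ℝ in Ioi 0, y * rexp (-(1 / 2) * y ^ 2) = 1 := by
        rw [← Complex.ofReal_inj, ← integral_complex_ofReal]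
        push_cast
        rw [h3]
        norm_num
      rw [h4, Real.sqrt_div (by norm_num), Real.sqrt_mul (by norm_num)]
      field_simp
      norm_num
    rw [← h1, ofReal_integral_eq_lintegral_ofReal]
    · have := (memLp_id_gaussianReal (μ := 0) (v := 1) 1).integrable (by norm_num)
      exact this.abs
    · exact Filter.Eventually.of_forall fun x => abs_nonneg x
  have hv : gaussianReal 0 v = (gaussianReal 0 1).map (fun x => √v * x) := by
    rw [gaussianReal_map_const_mul]
    congr 1
    · simp
    · ext; simp
  rw [hv, lintegral_map (by fun_prop) (by fun_prop)]
  simp_rw [abs_mul, ENNReal.ofReal_mul (abs_nonneg _)]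
  rw [lintegral_const_mul _ (by fun_prop), key, ← ENNReal.ofReal_mul (abs_nonneg _),
    abs_of_nonneg (Real.sqrt_nonneg _), ← Real.sqrt_mul (by positivity)]
  congr 2
  ring

theorem gaussianReal_withDensity_gaussianPDF {v : ℝ≥0} (hv : v ≠ 0) :
    (gaussianReal 0 v).withDensity (gaussianPDF 0 1)
      = ENNReal.ofReal (√(2 * π * (1 + v)))⁻¹ • gaussianReal 0 (v / (1 + v)) := by
  have hv' : (0 : ℝ) < v := by positivity
  rw [gaussianReal_of_var_ne_zero 0 hv, gaussianReal_of_var_ne_zero 0 (by positivity),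
    ← withDensity_mul _ (measurable_gaussianPDF 0 v) (measurable_gaussianPDF 0 1),
    ← withDensity_smul _ (measurable_gaussianPDF _ _)]
  congr 1
  ext x
  simp only [Pi.mul_apply, Pi.smul_apply, smul_eq_mul, gaussianPDF]
  rw [← ENNReal.ofReal_mul (gaussianPDFReal_nonneg _ _ _), ← ENNReal.ofReal_mul (by positivity)]
  congr 1
  simp only [gaussianPDFReal, sub_zero, NNReal.coe_one, mul_one, NNReal.coe_div, NNReal.coe_add]
  rw [mul_mul_mul_comm, ← Real.exp_add, ← mul_assoc, ← mul_inv, ← mul_inv, ← Real.sqrt_mul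
    (by positivity), ← Real.sqrt_mul (by positivity)]
  congr 2
  · congr 1
    field_simp
  · field_simp
    ring

section Pi

variable {ι : Type*} [Fintype ι]

local notation "γ" => Measure.pi fun _ : ι => gaussianReal 0 1

theorem hasGaussianLaw_pi_gaussianReal : HasGaussianLaw (fun b : ι → ℝ => b) γ := by
  refine iIndepFun.hasGaussianLaw (X := fun i (b : ι → ℝ) => b i) (fun i => ?_)
    (iIndepFun_pi (X := fun _ x => x) fun _ => aemeasurable_id)
  refine ⟨?_⟩
  rw [(measurePreserving_eval _ i).map_eq]
  infer_instance

theorem memLp_two_eval_pi_gaussianReal (i : ι) : MemLp (fun b : ι → ℝ => b i) 2 γ :=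
  (hasGaussianLaw_pi_gaussianReal.eval i).memLp_two

theorem covariance_sum_mul_pi_gaussianReal (u v : ι → ℝ) :
    cov[fun b => ∑ i, b i * u i, fun b => ∑ i, b i * v i; γ] = ∑ i, u i * v i := by
  classical
  have h : ∀ i j, cov[fun b : ι → ℝ => b i, fun b => b j; γ] = if i = j then 1 else 0 := by
    intro i j
    split_ifs with hij
    · subst hij
      rw [covariance_self (measurable_pi_apply i).aemeasurable]
      have := (measurePreserving_eval (fun _ : ι => gaussianReal 0 1) i).variance_fun_comp
        (f := id) (by fun_prop)
      simpa using this
    · exact ((iIndepFun_pi (X := fun _ x => x) fun _ => aemeasurable_id).indepFun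
        hij).covariance_eq_zero (memLp_two_eval_pi_gaussianReal i) (memLp_two_eval_pi_gaussianReal j)
  rw [covariance_fun_sum_fun_sum (fun i => (memLp_two_eval_pi_gaussianReal i).mul_const _)
    fun i => (memLp_two_eval_pi_gaussianReal i).mul_const _]
  simp_rw [covariance_mul_const_left, covariance_mul_const_right, h]
  simp [mul_comm]

theorem map_sum_mul_pi_gaussianReal (u : ι → ℝ) :
    Measure.map (fun b : ι → ℝ => ∑ i, b i * u i) γ = gaussianReal 0 (∑ i, u i ^ 2).toNNReal := by
  have hlaw : HasGaussianLaw (fun b : ι → ℝ => ∑ i, b i * u i) γ := by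
    have := hasGaussianLaw_pi_gaussianReal.map_fun
      (∑ i, (u i) • ContinuousLinearMap.proj (R := ℝ) (φ := fun _ : ι => ℝ) i)
    simpa [mul_comm] using this
  rw [hlaw.map_eq_gaussianReal]
  congr 1
  · rw [integral_finsetSum _ fun i _ =>
      ((memLp_two_eval_pi_gaussianReal i).mul_const _).integrable (by norm_num)]
    refine Finset.sum_eq_zero fun i _ => ?_
    rw [integral_mul_const, integral_eval (μ := fun _ : ι => gaussianReal 0 1)]
    simp
  · rw [← covariance_self hlaw.aemeasurable, covariance_sum_mul_pi_gaussianReal]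
    simp_rw [sq]

theorem lintegral_abs_mul_gaussianPDF_pi_gaussianReal (u v : ι → ℝ) (hu : 0 < ∑ i, u i ^ 2) :
    ∫⁻ b : ι → ℝ, ENNReal.ofReal |∑ i, b i * v i| * gaussianPDF 0 1 (∑ i, b i * u i) ∂γ
      = ENNReal.ofReal (1 / π * (√((1 + ∑ i, u i ^ 2) * (∑ i, v i ^ 2) - (∑ i, u i * v i) ^ 2)
          / (1 + ∑ i, u i ^ 2))) := by
  set U := ∑ i, u i ^ 2 with hU
  set V := ∑ i, v i ^ 2 with hV
  set C := ∑ i, u i * v i with hC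
  set β := C / U with hβ
  set w : ι → ℝ := fun i => v i - β * u i with hw
  set X : (ι → ℝ) → ℝ := fun b => ∑ i, b i * u i with hX
  set W : (ι → ℝ) → ℝ := fun b => ∑ i, b i * w i with hW
  have hXm : Measurable X := by fun_prop
  have hWm : Measurable W := by fun_prop
  have hWX : ∀ b : ι → ℝ, ∑ i, b i * v i = β * X b + W b := by
    intro b
    simp only [hX, hW, hw, Finset.mul_sum, ← Finset.sum_add_distrib]
    exact Finset.sum_congr rfl fun i _ => by ring
  have hK : ∑ i, w i ^ 2 = V - C ^ 2 / U := by
    have : ∑ i, w i ^ 2 = V - 2 * β * C + β ^ 2 * U := by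
      simp only [hV, hC, hU, hw, Finset.mul_sum, ← Finset.sum_add_distrib,
        ← Finset.sum_sub_distrib]
      exact Finset.sum_congr rfl fun i _ => by ring
    rw [this, hβ]
    field_simp
    ring
  have hindep : IndepFun X W γ := by
    refine HasGaussianLaw.indepFun_of_covariance_eq_zero ?_ ?_
    · have := hasGaussianLaw_pi_gaussianReal.map_fun (ContinuousLinearMap.prod
        (∑ i, (u i) • ContinuousLinearMap.proj (R := ℝ) (φ := fun _ : ι => ℝ) i)
        (∑ i, (w i) • ContinuousLinearMap.proj (R := ℝ) (φ := fun _ : ι => ℝ) i))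
      simpa [mul_comm, hX, hW] using this
    · rw [hX, hW, covariance_sum_mul_pi_gaussianReal]
      have : ∑ i, u i * w i = C - β * U := by
        simp only [hC, hU, hw, Finset.mul_sum, ← Finset.sum_sub_distrib]
        exact Finset.sum_congr rfl fun i _ => by ring
      rw [this, hβ]
      field_simp
      ring
  have hmap : Measure.map (fun b => (X b, W b)) γ
      = (gaussianReal 0 U.toNNReal).prod (gaussianReal 0 (V - C ^ 2 / U).toNNReal) := by
    rw [(indepFun_iff_map_prod_eq_prod_map_map hXm.aemeasurable hWm.aemeasurable).1 hindep,
      map_sum_mul_pi_gaussianReal, map_sum_mul_pi_gaussianReal, hK]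
  have hU0 : U.toNNReal ≠ 0 := by simpa using hu
  have hK0 : 0 ≤ V - C ^ 2 / U := hK ▸ Finset.sum_nonneg fun i _ => sq_nonneg _
  calc ∫⁻ b : ι → ℝ, ENNReal.ofReal |∑ i, b i * v i| * gaussianPDF 0 1 (∑ i, b i * u i) ∂γ
      = ∫⁻ p : ℝ × ℝ, gaussianPDF 0 1 p.1 * ENNReal.ofReal |β * p.1 + p.2|
          ∂(Measure.map (fun b => (X b, W b)) γ) := by
        rw [lintegral_map (by fun_prop) (by fun_prop)]
        refine lintegral_congr fun b => ?_
        rw [hWX, mul_comm]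
    _ = ∫⁻ p : ℝ × ℝ, ENNReal.ofReal |β * p.1 + p.2|
          ∂(((gaussianReal 0 U.toNNReal).withDensity (gaussianPDF 0 1)).prod
            (gaussianReal 0 (V - C ^ 2 / U).toNNReal)) := by
        rw [hmap, prod_withDensity_left (by fun_prop), lintegral_withDensity_eq_lintegral_mul _
          (by fun_prop) (by fun_prop)]
        rfl
    _ = ENNReal.ofReal (√(2 * π * (1 + U)))⁻¹ * ∫⁻ z, ENNReal.ofReal |z| ∂(gaussianReal 0
          (.mk (β ^ 2) (sq_nonneg β) * (U.toNNReal / (1 + U.toNNReal))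
            + (V - C ^ 2 / U).toNNReal)) := by
        rw [gaussianReal_withDensity_gaussianPDF hU0, Measure.prod_smul_left,
          lintegral_smul_measure, Real.coe_toNNReal _ hu.le, smul_eq_mul]
        congr 1
        have : gaussianReal 0
            (.mk (β ^ 2) (sq_nonneg β) * (U.toNNReal / (1 + U.toNNReal)) + (V - C ^ 2 / U).toNNReal)
            = Measure.map (fun p : ℝ × ℝ => β * p.1 + p.2)
              ((gaussianReal 0 (U.toNNReal / (1 + U.toNNReal))).prod
                (gaussianReal 0 (V - C ^ 2 / U).toNNReal)) := by
          have h1 := gaussianReal_map_const_mul (μ := 0) (v := U.toNNReal / (1 + U.toNNReal)) β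
          rw [mul_zero] at h1
          have h2 := gaussianReal_conv_gaussianReal (m₁ := 0) (m₂ := 0)
            (v₁ := .mk (β ^ 2) (sq_nonneg β) * (U.toNNReal / (1 + U.toNNReal)))
            (v₂ := (V - C ^ 2 / U).toNNReal)
          rw [add_zero, ← h1, Measure.conv] at h2
          rw [← h2, ← Measure.map_id (μ := gaussianReal 0 (V - C ^ 2 / U).toNNReal),
            Measure.map_prod_map _ _ (by fun_prop) measurable_id,
            Measure.map_map (by fun_prop) (by fun_prop), Measure.map_id]
          rfl
        rw [this, lintegral_map (by fun_prop) (by fun_prop)]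
    _ = _ := by
        rw [lintegral_ofReal_abs_gaussianReal, ← ENNReal.ofReal_mul (by positivity)]
        congr 1
        push_cast
        rw [Real.coe_toNNReal _ hu.le, Real.coe_toNNReal _ hK0]
        have h1 : 2 * (β ^ 2 * (U / (1 + U)) + (V - C ^ 2 / U)) / π
            = (2 * π * (1 + U)) * (((1 + U) * V - C ^ 2) / (π * (1 + U)) ^ 2) := by
          rw [hβ]
          field_simp
          ring
        rw [h1, Real.sqrt_mul (show 0 ≤ 2 * π * (1 + U) by positivity), ← mul_assoc,
          inv_mul_cancel₀ (by positivity), one_mul, Real.sqrt_div' _ (by positivity),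
          Real.sqrt_sq (by positivity)]
        field_simp

end Pi

theorem sum_range_mul_pow_mul_sub_one_sq (x : ℝ) (m : ℕ) :
    (∑ k ∈ Finset.range m, (k : ℝ) * x ^ k) * (x - 1) ^ 2
      = (m - 1) * x ^ (m + 1) - m * x ^ m + x := by
  induction m with
  | zero => simp
  | succ m ih =>
    rw [Finset.sum_range_succ, add_mul, ih]
    push_cast
    ring

theorem sum_range_sq_mul_pow_mul_sub_one_pow_three (x : ℝ) (m : ℕ) :
    (∑ k ∈ Finset.range m, (k : ℝ) ^ 2 * x ^ k) * (x - 1) ^ 3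
      = (m - 1) ^ 2 * x ^ (m + 2) - (2 * m ^ 2 - 2 * m - 1) * x ^ (m + 1) + m ^ 2 * x ^ m
        - x ^ 2 - x := by
  induction m with
  | zero => simp
  | succ m ih =>
    rw [Finset.sum_range_succ, add_mul, ih]
    push_cast
    ring

theorem kac_variance_identity (n : ℕ) {t : ℝ} (h0 : t ≠ 0) (h1 : t ^ 2 ≠ 1) :
    ((1 + ∑ i : Fin n, (t ^ (i + 1 : ℕ)) ^ 2) * (∑ i : Fin n, ((i + 1 : ℝ) * t ^ (i : ℕ)) ^ 2)
        - (∑ i : Fin n, t ^ (i + 1 : ℕ) * ((i + 1 : ℝ) * t ^ (i : ℕ))) ^ 2)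
        / (1 + ∑ i : Fin n, (t ^ (i + 1 : ℕ)) ^ 2) ^ 2
      = 1 / (t ^ 2 - 1) ^ 2
        - ((n + 1 : ℝ) ^ 2 * t ^ (2 * n)) / (t ^ (2 * n + 2) - 1) ^ 2 := by
  have hU : 1 + ∑ i : Fin n, (t ^ (i + 1 : ℕ)) ^ 2 = ∑ k ∈ Finset.range (n + 1), (t ^ 2) ^ k := by
    rw [Fin.sum_univ_eq_sum_range (fun i => (t ^ (i + 1)) ^ 2), Finset.sum_range_succ', add_comm]
    simp [pow_right_comm]
  have hC : t * ∑ i : Fin n, t ^ (i + 1 : ℕ) * ((i + 1 : ℝ) * t ^ (i : ℕ))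
      = ∑ k ∈ Finset.range (n + 1), (k : ℝ) * (t ^ 2) ^ k := by
    rw [Fin.sum_univ_eq_sum_range (fun i => t ^ (i + 1) * ((i + 1 : ℝ) * t ^ i)),
      Finset.sum_range_succ', Finset.mul_sum]
    simp only [CharP.cast_eq_zero, zero_mul, add_zero]
    refine Finset.sum_congr rfl fun i _ => ?_
    push_cast
    ring
  have hV : t ^ 2 * ∑ i : Fin n, ((i + 1 : ℝ) * t ^ (i : ℕ)) ^ 2
      = ∑ k ∈ Finset.range (n + 1), (k : ℝ) ^ 2 * (t ^ 2) ^ k := by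
    rw [Fin.sum_univ_eq_sum_range (fun i => ((i + 1 : ℝ) * t ^ i) ^ 2),
      Finset.sum_range_succ', Finset.mul_sum]
    simp only [CharP.cast_eq_zero, ne_eq, OfNat.ofNat_ne_zero, not_false_eq_true, zero_pow,
      zero_mul, add_zero]
    refine Finset.sum_congr rfl fun i _ => ?_
    push_cast
    ring
  have hS0 := geom_sum_eq h1 (n + 1)
  have hS1 := sum_range_mul_pow_mul_sub_one_sq (t ^ 2) (n + 1)
  have hS2 := sum_range_sq_mul_pow_mul_sub_one_pow_three (t ^ 2) (n + 1)
  rw [← hC] at hS1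
  rw [← hV] at hS2
  rw [hU, hS0]
  set C := ∑ i : Fin n, t ^ (i + 1 : ℕ) * ((i + 1 : ℝ) * t ^ (i : ℕ))
  set V := ∑ i : Fin n, ((i + 1 : ℝ) * t ^ (i : ℕ)) ^ 2
  have hx1 : t ^ 2 - 1 ≠ 0 := sub_ne_zero.2 h1
  have hy1 : (t ^ 2) ^ (n + 1) - 1 ≠ 0 :=
    sub_ne_zero.2 fun h => h1 ((pow_eq_one_iff_of_nonneg (sq_nonneg t) n.succ_ne_zero).1 h)
  rw [show t ^ (2 * n + 2) = (t ^ 2) ^ (n + 1) by ring,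
    show t ^ (2 * n) = (t ^ 2) ^ (n + 1) / t ^ 2 by field_simp; ring]
  have hC' : C = ((n + 1 - 1) * (t ^ 2) ^ (n + 1) * t ^ 2 - (n + 1) * (t ^ 2) ^ (n + 1) + t ^ 2)
      / (t * (t ^ 2 - 1) ^ 2) := by
    rw [eq_div_iff (by positivity)]
    push_cast at hS1
    linear_combination hS1
  have hV' : V = ((n + 1 - 1) ^ 2 * (t ^ 2) ^ (n + 1) * (t ^ 2) ^ 2
      - (2 * (n + 1) ^ 2 - 2 * (n + 1) - 1) * (t ^ 2) ^ (n + 1) * t ^ 2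
      + (n + 1) ^ 2 * (t ^ 2) ^ (n + 1) - (t ^ 2) ^ 2 - t ^ 2) / (t ^ 2 * (t ^ 2 - 1) ^ 3) := by
    rw [eq_div_iff (by positivity)]
    push_cast at hS2
    linear_combination hS2
  rw [hC', hV']
  generalize (t ^ 2) ^ (n + 1) = y at *
  field_simp
  ring

theorem pi_gaussianReal_absolutelyContinuous (n : ℕ) :
    (Measure.pi fun _ : Fin n => gaussianReal 0 1) ≪ volume := by
  induction n with
  | zero =>
    rw [volume_pi, Measure.pi_of_empty, Measure.pi_of_empty]
  | succ n ih =>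
    have h1 := (measurePreserving_piFinSuccAbove
      (fun _ : Fin (n + 1) => gaussianReal 0 1) 0).symm.map_eq
    have h2 := (volume_preserving_piFinSuccAbove (fun _ : Fin (n + 1) => ℝ) 0).symm.map_eq
    rw [← h1, ← h2]
    exact ((gaussianReal_absolutelyContinuous 0 one_ne_zero).prod ih).map
      (MeasurableEquiv.measurable _)

/-- The derivative at `(t, b)` of `(t, b) ↦ (-q b t, b)`, where `d` and `L` are the derivatives of
`q` with respect to `t` and `b`. -/
noncomputable def shearDeriv {n : ℕ} (d : ℝ) (L : (Fin n → ℝ) →L[ℝ] ℝ) :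
    ℝ × (Fin n → ℝ) →L[ℝ] ℝ × (Fin n → ℝ) :=
  (-(d • ContinuousLinearMap.fst ℝ ℝ (Fin n → ℝ) + L.comp (ContinuousLinearMap.snd ℝ ℝ _))).prod
    (ContinuousLinearMap.snd ℝ ℝ _)

theorem det_shearDeriv {n : ℕ} (d : ℝ) (L : (Fin n → ℝ) →L[ℝ] ℝ) :
    (shearDeriv d L).det = -d := by
  let b := (Module.Basis.singleton Unit ℝ).prod (Pi.basisFun ℝ (Fin n))
  have h : LinearMap.toMatrix b b (shearDeriv d L : ℝ × (Fin n → ℝ) →ₗ[ℝ] ℝ × (Fin n → ℝ))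
      = Matrix.fromBlocks (Matrix.of fun _ _ => -d) (Matrix.of fun _ j => -L (Pi.single j 1)) 0
        1 := by
    ext i j
    rcases i with i | i <;> rcases j with j | j <;>
      simp [b, LinearMap.toMatrix_apply, shearDeriv, Matrix.one_apply, Pi.single_apply]
  rw [ContinuousLinearMap.det, ← LinearMap.det_toMatrix b, h, Matrix.det_fromBlocks_zero₂₁]
  simp

/-- Sends `(t, b)` to `(s, b)`, where `s` is the constant coefficient for which the polynomial with
nonconstant coefficients `b` vanishes at `t`. -/
def kacMap (n : ℕ) (x : ℝ × (Fin n → ℝ)) : ℝ × (Fin n → ℝ) :=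
  (-∑ i, x.2 i * x.1 ^ (i + 1 : ℕ), x.2)

/-- The derivative of `kacMap`. -/
noncomputable def kacMapDeriv (n : ℕ) (x : ℝ × (Fin n → ℝ)) :
    ℝ × (Fin n → ℝ) →L[ℝ] ℝ × (Fin n → ℝ) :=
  shearDeriv (∑ i : Fin n, x.2 i * ((i + 1 : ℝ) * x.1 ^ (i : ℕ)))
    (∑ i : Fin n, x.1 ^ (i + 1 : ℕ) • ContinuousLinearMap.proj (R := ℝ) (φ := fun _ => ℝ) i)

theorem hasFDerivAt_kacMap (n : ℕ) (x : ℝ × (Fin n → ℝ)) :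
    HasFDerivAt (kacMap n) (kacMapDeriv n x) x := by
  have h2 : ∀ i : Fin n, HasFDerivAt (fun y : ℝ × (Fin n → ℝ) => y.2 i)
      ((ContinuousLinearMap.proj (R := ℝ) (φ := fun _ : Fin n => ℝ) i).comp
        (ContinuousLinearMap.snd ℝ ℝ (Fin n → ℝ))) x := fun i =>
    ((ContinuousLinearMap.proj (R := ℝ) (φ := fun _ : Fin n => ℝ) i).comp
        (ContinuousLinearMap.snd ℝ ℝ (Fin n → ℝ))).hasFDerivAt
  have h1 : ∀ i : Fin n, HasFDerivAt (fun y : ℝ × (Fin n → ℝ) => y.1 ^ (i + 1 : ℕ)) _ x := fun i =>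
    (hasFDerivAt_fst (𝕜 := ℝ) (p := x)).pow (i + 1 : ℕ)
  have h3 := (HasFDerivAt.fun_sum (u := Finset.univ) fun i _ => (h2 i).mul (h1 i)).neg.prodMk
    (hasFDerivAt_snd (p := x))
  refine h3.congr_fderiv ?_
  ext <;> simp [kacMapDeriv, shearDeriv, Finset.sum_add_distrib]

theorem coe_encard_zeros_eq {n : ℕ} (I : Set ℝ) (p : ℝ × (Fin n → ℝ)) :
    {t : ℝ | t ∈ I ∧ p.1 + ∑ i : Fin n, p.2 i * t ^ (i + 1 : ℕ) = 0}.encard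
      = {x ∈ I ×ˢ (univ : Set (Fin n → ℝ)) | kacMap n x = p}.encard := by
  have hinj : Function.Injective fun t : ℝ => (t, p.2) := fun s t h => (Prod.ext_iff.1 h).1
  rw [← hinj.encard_image]
  congr 1
  ext ⟨t, b⟩
  simp only [kacMap, mem_image, mem_ofPred_eq, Prod.ext_iff, mem_prod, mem_univ, and_true]
  constructor
  · rintro ⟨s, ⟨hs, h⟩, rfl, rfl⟩
    exact ⟨hs, by linarith, rfl⟩
  · rintro ⟨ht, h, rfl⟩
    exact ⟨t, ⟨ht, by linarith⟩, rfl, rfl⟩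

theorem lintegral_encard_zeros_eq_setLIntegral (n : ℕ) {I : Set ℝ} (hI : MeasurableSet I) :
    ∫⁻ a : Fin (n + 1) → ℝ,
        ({t : ℝ | t ∈ I ∧ ∑ i : Fin (n + 1), a i * t ^ (i : ℕ) = 0}.encard : ℝ≥0∞)
        ∂(Measure.pi fun _ => gaussianReal 0 1)
      = ∫⁻ t in I, ∫⁻ b : Fin n → ℝ,
          ENNReal.ofReal |∑ i, b i * ((i + 1 : ℝ) * t ^ (i : ℕ))|
            * gaussianPDF 0 1 (∑ i, b i * t ^ (i + 1 : ℕ))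
          ∂(Measure.pi fun _ => gaussianReal 0 1) := by
  set γ : Measure (Fin n → ℝ) := Measure.pi fun _ => gaussianReal 0 1 with hγ
  set D : (Fin n → ℝ) → ℝ≥0∞ := γ.rnDeriv volume with hD
  have hDm : Measurable D := Measure.measurable_rnDeriv _ _
  have hDγ : volume.withDensity D = γ :=
    Measure.withDensity_rnDeriv_eq _ _ (pi_gaussianReal_absolutelyContinuous n)
  have hprod : (gaussianReal 0 1).prod γ
      = (volume : Measure (ℝ × (Fin n → ℝ))).withDensity
        fun p => gaussianPDF 0 1 p.1 * D p.2 := by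
    have : SFinite (volume.withDensity D) := hDγ ▸ inferInstance
    rw [← hDγ, gaussianReal_of_var_ne_zero 0 one_ne_zero,
      prod_withDensity (measurable_gaussianPDF 0 1) hDm]
    rfl
  have hdet : ∀ x : ℝ × (Fin n → ℝ), (kacMapDeriv n x).det
      = -∑ i : Fin n, x.2 i * ((i + 1 : ℝ) * x.1 ^ (i : ℕ)) := fun x => det_shearDeriv _ _
  have hs : MeasurableSet (I ×ˢ (univ : Set (Fin n → ℝ))) := hI.prod MeasurableSet.univ
  have hdm : MeasurableSet {x : ℝ × (Fin n → ℝ) | (kacMapDeriv n x).det = 0} := by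
    simp_rw [hdet]
    exact measurableSet_eq_fun (by fun_prop) (by fun_prop)
  have hf : ∀ x ∈ I ×ˢ (univ : Set (Fin n → ℝ)),
      HasFDerivWithinAt (kacMap n) (kacMapDeriv n x) (I ×ˢ univ) x := fun x _ =>
    (hasFDerivAt_kacMap n x).hasFDerivWithinAt
  have : (volume : Measure (ℝ × (Fin n → ℝ))).IsAddHaarMeasure :=
    inferInstanceAs (Measure.IsAddHaarMeasure ((volume : Measure ℝ).prod volume))
  calc _ = ∫⁻ p : ℝ × (Fin n → ℝ),
        ({x ∈ I ×ˢ (univ : Set (Fin n → ℝ)) | kacMap n x = p}.encard : ℝ≥0∞)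
          ∂((gaussianReal 0 1).prod γ) := by
        rw [← (measurePreserving_piFinSuccAbove
          (fun _ : Fin (n + 1) => gaussianReal 0 1) 0).lintegral_comp_emb
          (MeasurableEquiv.measurableEmbedding _)]
        refine lintegral_congr fun a => ?_
        rw [← coe_encard_zeros_eq]
        simp [Fin.sum_univ_succ, MeasurableEquiv.piFinSuccAbove, Fin.tail]
    _ = ∫⁻ p : ℝ × (Fin n → ℝ),
        ({x ∈ I ×ˢ (univ : Set (Fin n → ℝ)) | kacMap n x = p}.encard : ℝ≥0∞)
          * (gaussianPDF 0 1 p.1 * D p.2) := by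
        rw [hprod, lintegral_withDensity_eq_lintegral_mul₀ (by fun_prop)
          (aemeasurable_coe_encard_fiber volume hs hdm hf)]
        simp_rw [Pi.mul_apply, mul_comm]
    _ = ∫⁻ x in I ×ˢ (univ : Set (Fin n → ℝ)), ENNReal.ofReal |(kacMapDeriv n x).det|
          * (gaussianPDF 0 1 (kacMap n x).1 * D (kacMap n x).2) :=
        lintegral_coe_encard_fiber_mul volume hs hdm hf (by fun_prop)
    _ = ∫⁻ t in I, ∫⁻ b : Fin n → ℝ, D b *
          (ENNReal.ofReal |∑ i, b i * ((i + 1 : ℝ) * t ^ (i : ℕ))|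
            * gaussianPDF 0 1 (∑ i, b i * t ^ (i + 1 : ℕ))) := by
        simp_rw [hdet]
        rw [Measure.volume_eq_prod, ← Measure.prod_restrict, Measure.restrict_univ,
          lintegral_prod _ (by unfold kacMap; fun_prop)]
        refine lintegral_congr fun t => lintegral_congr fun b => ?_
        simp only [kacMap, abs_neg, gaussianPDF, gaussianPDFReal, sub_zero, neg_sq]
        ring
    _ = _ := by
        refine lintegral_congr fun t => ?_
        rw [← hDγ, lintegral_withDensity_eq_lintegral_mul _ hDm (by fun_prop)]
        rfl

/-- The density of real zeros of a Kac random polynomial (Section 2.4): for every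
measurable `I ⊆ ℝ`, the expected number of zeros of `p` in `I` is `∫_I ρₙ(t) dt` where
`ρₙ(t) = (1/π) √(1/(t²-1)² - (n+1)²·t^(2n)/(t^(2n+2)-1)²)`. -/
theorem kac_density (n : ℕ) (hn : 1 ≤ n) (I : Set ℝ) (hI : MeasurableSet I) :
    ∫⁻ a : Fin (n + 1) → ℝ,
        ({t : ℝ | t ∈ I ∧ ∑ i : Fin (n + 1), a i * t ^ (i : ℕ) = 0}.encard : ℝ≥0∞)
        ∂(Measure.pi fun _ => gaussianReal 0 1)
      = ∫⁻ t in I, ENNReal.ofReal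
          ((1 / π) * Real.sqrt (1 / (t ^ 2 - 1) ^ 2
            - ((n + 1 : ℝ) ^ 2 * t ^ (2 * n)) / (t ^ (2 * n + 2) - 1) ^ 2)) := by
  rw [lintegral_encard_zeros_eq_setLIntegral n hI]
  have h0 : ∀ᵐ t : ℝ ∂volume.restrict I, t ∉ ({0, 1, -1} : Set ℝ) :=
    ae_restrict_of_ae (measure_eq_zero_iff_ae_notMem.1 (Set.Finite.measure_zero (by simp) _))
  refine lintegral_congr_ae ?_
  filter_upwards [h0] with t ht
  simp only [mem_insert_iff, mem_singleton_iff, not_or] at ht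
  obtain ⟨ht0, ht1, ht2⟩ := ht
  have ht1 : t ^ 2 ≠ 1 := by
    rw [Ne, sq_eq_one_iff]
    exact not_or.2 ⟨ht1, ht2⟩
  have hpos : 0 < ∑ i : Fin n, (t ^ (i + 1 : ℕ)) ^ 2 :=
    Finset.sum_pos (fun i _ => by positivity) ⟨⟨0, hn⟩, Finset.mem_univ _⟩
  rw [lintegral_abs_mul_gaussianPDF_pi_gaussianReal (fun i : Fin n => t ^ (i + 1 : ℕ)) _ hpos,
    ← kac_variance_identity n ht0 ht1, Real.sqrt_div' _ (by positivity),
    Real.sqrt_sq (by positivity)]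
end

section
/- Let n ≥ 0 and let a, b, c, d be real polynomials each of degree at most n such that a(t)² + b(t)² + c(t)² + d(t)² > 0 for every real t. Define f₀ = 2(ac + bd), f₁ = 2(bc − ad), f₂ = a² + b² − c² − d², and let γ(t) = (f₀(t), f₁(t), f₂(t)) / ‖(f₀(t), f₁(t), f₂(t))‖ ∈ S² ⊂ ℝ³ (γ is the stereographic image on the Riemann sphere of the rational function r(t) = (a(t)+i·b(t))/(c(t)+i·d(t))). Then the length of γ satisfies ∫_ℝ ‖γ′(t)‖ dt ≤ 2nπ. (Spijker's lemma on the Riemann sphere, Section 3.1.3.) -/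
open MeasureTheory Real Set
open scoped ENNReal NNReal
open ProbabilityTheory

/-- If a differentiable function takes every value at most `m` times and has finitely many critical
points, then the absolute derivative has integral at most `m * volume J` over the preimage of `J`. -/
theorem lintegral_indicator_mul_abs_deriv_le {f f' : ℝ → ℝ} (hf : ∀ t, HasDerivAt f (f' t) t)
    (Z : Finset ℝ) (hZ : ∀ t, f' t = 0 → t ∈ Z) (m : ℕ)
    (hm : ∀ (y : ℝ) (s : Finset ℝ), (∀ t ∈ s, f t = y) → s.card ≤ m)
    {J : Set ℝ} (hJ : MeasurableSet J) :
    ∫⁻ t, J.indicator 1 (f t) * ENNReal.ofReal |f' t| ≤ m * volume J := by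
  let k : ℝ → ℕ := fun t ↦ (Z.filter (· < t)).card
  let S : ℕ → Set ℝ := fun i ↦ {t | t ∉ Z ∧ k t = i}
  have hkmono : Monotone k := fun x y hxy ↦
    Finset.card_le_card fun z ↦ by simpa using fun hz hzx ↦ ⟨hz, hzx.trans_le hxy⟩
  have hSmeas (i : ℕ) : MeasurableSet (S i) :=
    Z.measurableSet.compl.inter (hkmono.measurable (measurableSet_singleton i))
  have hSdisj {i j : ℕ} {t : ℝ} (hi : t ∈ S i) (hj : t ∈ S j) : i = j := hi.2.symm.trans hj.2
  have hcont : Continuous f := continuous_iff_continuousAt.2 fun t ↦ (hf t).continuousAt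
  have hlt {i : ℕ} {x y : ℝ} (hx : x ∈ S i) (hy : y ∈ S i) (hxy : x < y) : f x ≠ f y := by
    intro h
    obtain ⟨c, hc, hc0⟩ := exists_hasDerivAt_eq_zero hxy hcont.continuousOn h fun t _ ↦ hf t
    have hcZ := hZ c hc0
    have : k x < k y := Finset.card_lt_card <| by
      refine Finset.ssubset_iff_subset_ne.2 ⟨fun z ↦ ?_, fun h ↦ ?_⟩
      · simpa using fun hz hzx ↦ ⟨hz, hzx.trans hxy⟩
      · have : c ∈ Z.filter (· < x) := h ▸ by simp [hcZ, hc.2]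
        exact (Finset.mem_filter.1 this).2.not_gt hc.1
    exact this.ne (hx.2.trans hy.2.symm)
  have hinj (i : ℕ) : InjOn f (S i) := fun x hx y hy h ↦ by
    rcases lt_trichotomy x y with hxy | hxy | hxy
    · exact (hlt hx hy hxy h).elim
    · exact hxy
    · exact (hlt hy hx hxy h.symm).elim
  have himg (i : ℕ) : MeasurableSet (f '' S i) :=
    (hSmeas i).image_of_continuousOn_injOn hcont.continuousOn (hinj i)
  have hcover : (⋃ i ∈ Finset.range (Z.card + 1), S i) = (Z : Set ℝ)ᶜ := by
    ext t
    have : k t ≤ Z.card := Finset.card_filter_le _ _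
    simpa [S] using fun _ ↦ this
  calc ∫⁻ t, J.indicator 1 (f t) * ENNReal.ofReal |f' t|
      = ∫⁻ t in (Z : Set ℝ)ᶜ, J.indicator 1 (f t) * ENNReal.ofReal |f' t| := by
        rw [← setLIntegral_univ]
        refine setLIntegral_congr ?_
        exact (ae_eq_univ.2 (by simpa using Z.finite_toSet.measure_zero volume)).symm
    _ = ∑ i ∈ Finset.range (Z.card + 1),
          ∫⁻ t in S i, J.indicator 1 (f t) * ENNReal.ofReal |f' t| := by
        rw [← hcover]
        refine lintegral_biUnion_finset (fun i _ j _ hij ↦ ?_) (fun i _ ↦ hSmeas i) _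
        exact Set.disjoint_left.2 fun t hi hj ↦ hij (hSdisj hi hj)
    _ = ∑ i ∈ Finset.range (Z.card + 1), ∫⁻ y in f '' S i, J.indicator 1 y := by
        refine Finset.sum_congr rfl fun i _ ↦ ?_
        rw [lintegral_image_eq_lintegral_abs_deriv_mul (hSmeas i)
          (fun t _ ↦ (hf t).hasDerivWithinAt) (hinj i)]
        simp_rw [mul_comm]
    _ = ∫⁻ y, ∑ i ∈ Finset.range (Z.card + 1), (f '' S i).indicator (J.indicator 1) y := by
        rw [lintegral_finsetSum]
        · simp_rw [lintegral_indicator (himg _)]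
        · exact fun i _ ↦ (measurable_one.indicator hJ).indicator (himg i)
    _ ≤ ∫⁻ y, m * J.indicator 1 y := by
        refine lintegral_mono fun y ↦ ?_
        by_cases hy : y ∈ J
        · classical
          let K := (Finset.range (Z.card + 1)).filter fun i ↦ y ∈ f '' S i
          have hK : ∀ i ∈ K, ∃ t ∈ S i, f t = y := fun i hi ↦ (Finset.mem_filter.1 hi).2
          choose! τ hτ hτy using hK
          have hcard : K.card ≤ m := by
            rw [← Finset.card_image_of_injOn (f := τ) (s := K) fun i hi j hj h ↦
              hSdisj (hτ i hi) (h ▸ hτ j hj)]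
            refine hm y _ fun t ht ↦ ?_
            obtain ⟨i, hi, rfl⟩ := Finset.mem_image.1 ht
            exact hτy i hi
          have : ∑ i ∈ Finset.range (Z.card + 1), (f '' S i).indicator (J.indicator 1) y
              = (K.card : ℝ≥0∞) := by
            simp only [Set.indicator_apply, hy, if_true, Pi.one_apply, K,
              Finset.card_filter, Nat.cast_sum, Nat.cast_ite, Nat.cast_one, Nat.cast_zero]
          simpa [this, hy] using hcard
        · simp [hy]
    _ = m * volume J := by
        rw [lintegral_const_mul _ (measurable_one.indicator hJ), lintegral_indicator_one hJ]

/-- A quotient of real polynomials of degree at most `m`, whose denominator has no zero, covers each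
set `J` with multiplicity at most `m`. -/
theorem lintegral_indicator_mul_abs_deriv_div_le {P N : Polynomial ℝ} {m : ℕ}
    (hP : P.natDegree ≤ m) (hN : N.natDegree ≤ m) (hN0 : ∀ t, N.eval t ≠ 0)
    {J : Set ℝ} (hJ : MeasurableSet J) :
    ∫⁻ t, J.indicator 1 (P.eval t / N.eval t) *
      ENNReal.ofReal |deriv (fun t ↦ P.eval t / N.eval t) t| ≤ m * volume J := by
  let W := P.derivative * N - P * N.derivative
  have hd (t : ℝ) : HasDerivAt (fun t ↦ P.eval t / N.eval t) (W.eval t / N.eval t ^ 2) t := by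
    simpa [W] using (P.hasDerivAt t).fun_div (N.hasDerivAt t) (hN0 t)
  simp_rw [fun t ↦ (hd t).deriv]
  by_cases hW : W = 0
  · simp [hW]
  refine lintegral_indicator_mul_abs_deriv_le hd W.roots.toFinset (fun t ht ↦ ?_) m
    (fun y s hs ↦ ?_) hJ
  · simpa [hW, hN0 t] using ht
  · let Q := P - Polynomial.C y * N
    have hQ : Q ≠ 0 := fun h ↦ hW <| by
      simp only [W, sub_eq_zero.1 h, Polynomial.derivative_mul, Polynomial.derivative_C]
      ring
    have hQdeg : Q.natDegree ≤ m :=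
      (Polynomial.natDegree_sub_le _ _).trans
        (max_le hP ((Polynomial.natDegree_C_mul_le _ _).trans hN))
    refine (Polynomial.card_le_degree_of_subset_roots (p := Q) fun t ht ↦ ?_).trans hQdeg
    rw [Polynomial.mem_roots hQ]
    simp [Q, ← hs t ht, hN0 t]

/-- The first absolute moment of a standard Gaussian is `√(2 / π)`. -/
theorem lintegral_abs_gaussianReal :
    ∫⁻ x, ENNReal.ofReal |x| ∂(gaussianReal 0 1) = ENNReal.ofReal √(2 / π) := by
  have hint : Integrable (fun x : ℝ ↦ |x|) (gaussianReal 0 1) :=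
    (IsGaussian.integrable_id (μ := gaussianReal 0 1)).abs
  rw [← ofReal_integral_eq_lintegral_ofReal hint (ae_of_all _ fun x ↦ abs_nonneg x),
    integral_gaussianReal_eq_integral_smul one_ne_zero]
  congr 1
  have h := integral_comp_abs (f := fun x : ℝ ↦ gaussianPDFReal 0 1 x • x)
  simp only [gaussianPDFReal_def, sq_abs, sub_zero] at h ⊢
  rw [h]
  have h2 := integral_rpow_mul_exp_neg_mul_rpow (p := 2) (q := 1) (b := 1 / 2)
    (by norm_num) (by norm_num) (by norm_num)
  norm_num at h2
  simp only [smul_eq_mul, NNReal.coe_one, mul_one, mul_assoc, integral_const_mul]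
  have h3 : ∫ x in Ioi (0 : ℝ), rexp (-x ^ 2 / 2) * x = 1 := by
    rw [← h2]
    congr 1 with x
    rw [mul_comm]; congr 2; ring
  rw [h3]
  rw [Real.sqrt_div (by norm_num), Real.sqrt_mul (by norm_num)]
  field_simp
  norm_num

/-- The standard Gaussian mass of `(-ε, ε)` is at least `2ε` times the density at `ε`. -/
theorem le_gaussianReal_Ioo (ε : ℝ) :
    ENNReal.ofReal ((√(2 * π))⁻¹ * exp (-ε ^ 2 / 2) * (2 * ε)) ≤
      gaussianReal 0 1 (Ioo (-ε) ε) := by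
  rw [gaussianReal_apply 0 one_ne_zero]
  calc _ = ∫⁻ _ in Ioo (-ε) ε, ENNReal.ofReal ((√(2 * π))⁻¹ * exp (-ε ^ 2 / 2)) := by
        rw [setLIntegral_const, Real.volume_Ioo, ← ENNReal.ofReal_mul (by positivity)]
        congr 2; ring
    _ ≤ _ := by
        refine setLIntegral_mono (measurable_gaussianPDF _ _) fun x hx ↦ ?_
        simp only [gaussianPDF, gaussianPDFReal, NNReal.coe_one, mul_one, sub_zero]
        gcongr ENNReal.ofReal (_ * exp (-?_ / 2))
        exact sq_le_sq' hx.1.le hx.2.le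

/-- For orthogonal `e` and `v` with `e` a unit vector, the components of a standard Gaussian vector
along `e` and `v` are independent Gaussians. -/
theorem lintegral_indicator_mul_abs_inner_stdGaussian
    {E : Type*} [NormedAddCommGroup E] [InnerProductSpace ℝ E] [FiniteDimensional ℝ E]
    [MeasurableSpace E] [BorelSpace E] {e v : E} (he : ‖e‖ = 1) (hev : inner ℝ e v = 0)
    {J : Set ℝ} (hJ : MeasurableSet J) :
    ∫⁻ u, J.indicator 1 (inner ℝ u e) * ENNReal.ofReal |inner ℝ u v| ∂(stdGaussian E) =
      gaussianReal 0 1 J * ENNReal.ofReal √(2 / π) * ENNReal.ofReal ‖v‖ := by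
  classical
  rcases eq_or_ne v 0 with rfl | hv
  · simp
  have hv' : ‖v‖ ≠ 0 := norm_ne_zero_iff.2 hv
  let f := ‖v‖⁻¹ • v
  have hvf : v = ‖v‖ • f := by simp [f, smul_smul, hv']
  have hef : inner ℝ e f = 0 := by simp [f, inner_smul_right, hev]
  have hf : ‖f‖ = 1 := by simp [f, norm_smul, hv']
  have hne : e ≠ f := by
    rintro h
    rw [← h, real_inner_self_eq_norm_sq, he] at hef
    norm_num at hef
  have hort : Orthonormal ℝ ((↑) : ({e, f} : Set E) → E) := by
    rw [orthonormal_subtype_iff_ite]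
    rintro x (rfl | rfl) y (rfl | rfl) <;>
      simp [he, hf, hef, hne, hne.symm, real_inner_comm]
  obtain ⟨s, b, hs, hb⟩ := hort.exists_orthonormalBasis_extension
  let i : s := ⟨e, hs (by simp)⟩
  let j : s := ⟨f, hs (by simp)⟩
  have hi : b i = e := by simp [hb, i]
  have hj : b j = f := by simp [hb, j]
  have hij : i ≠ j := fun h ↦ hne (congrArg Subtype.val h)
  have hin (k : s) (x : s → ℝ) : inner ℝ (∑ l, x l • b l) (b k) = x k := by
    simp [sum_inner, inner_smul_left, b.inner_eq_ite]
  have hJm : Measurable (J.indicator (1 : ℝ → ℝ≥0∞)) := measurable_one.indicator hJ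
  have habs : Measurable fun x : ℝ ↦ ENNReal.ofReal |x| := by fun_prop
  have hind := (iIndepFun_pi (μ := fun _ : s ↦ gaussianReal 0 1) (X := fun _ x ↦ x)
    (fun _ ↦ aemeasurable_id)).indepFun hij
  have hmp (k : s) := measurePreserving_eval (fun _ : s ↦ gaussianReal 0 1) k
  rw [stdGaussian_eq_map_pi_orthonormalBasis b, lintegral_map (by fun_prop) (by fun_prop)]
  calc _ = ∫⁻ x : s → ℝ, J.indicator 1 (x i) * ENNReal.ofReal |x j| * ENNReal.ofReal ‖v‖
          ∂(Measure.pi fun _ ↦ gaussianReal 0 1) := by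
        refine lintegral_congr fun x ↦ ?_
        rw [hvf, inner_smul_right, ← hi, ← hj, hin, hin, hj, ← hvf, abs_mul, abs_norm, mul_comm ‖v‖,
          ENNReal.ofReal_mul (abs_nonneg _), mul_assoc]
    _ = (∫⁻ x : s → ℝ, J.indicator 1 (x i) ∂(Measure.pi fun _ ↦ gaussianReal 0 1)) *
          (∫⁻ x : s → ℝ, ENNReal.ofReal |x j| ∂(Measure.pi fun _ ↦ gaussianReal 0 1)) *
          ENNReal.ofReal ‖v‖ := by
        rw [lintegral_mul_const _ (by fun_prop)]
        congr 1
        exact lintegral_mul_eq_lintegral_mul_lintegral_of_indepFun''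
          (hJm.comp (measurable_pi_apply i)).aemeasurable
          (Measurable.aemeasurable (by fun_prop))
          (hind.comp hJm habs)
    _ = _ := by
        rw [(hmp i).lintegral_comp hJm,
          (hmp j).lintegral_comp habs,
          lintegral_indicator_one hJ, lintegral_abs_gaussianReal]

/-- A Crofton-type bound: if for every `u` the function `⟪u, γ⟫` covers each set `J` with
multiplicity at most `m`, then the curve `γ` on the unit sphere has length at most `m * π`. -/
theorem lintegral_norm_deriv_le_of_unit
    {E : Type*} [NormedAddCommGroup E] [InnerProductSpace ℝ E] [FiniteDimensional ℝ E]
    [MeasurableSpace E] [BorelSpace E] {γ : ℝ → E} (hγ : Differentiable ℝ γ)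
    (hnorm : ∀ t, ‖γ t‖ = 1) {m : ℕ}
    (hm : ∀ (u : E) (J : Set ℝ), MeasurableSet J →
      ∫⁻ t, J.indicator 1 (inner ℝ u (γ t)) * ENNReal.ofReal |inner ℝ u (deriv γ t)| ≤
        m * volume J) :
    ∫⁻ t, ENNReal.ofReal ‖deriv γ t‖ ≤ ENNReal.ofReal (m * π) := by
  have horth (t : ℝ) : inner ℝ (γ t) (deriv γ t) = 0 := by
    have h := (hγ t).hasDerivAt.norm_sq
    simp only [hnorm] at h
    simpa using h.unique (hasDerivAt_const t _)
  have hderiv : Measurable (deriv γ) := measurable_deriv γ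
  have hγm : Measurable γ := hγ.continuous.measurable
  set L := ∫⁻ t, ENNReal.ofReal ‖deriv γ t‖ with hL
  have key (J : Set ℝ) (hJ : MeasurableSet J) :
      gaussianReal 0 1 J * ENNReal.ofReal √(2 / π) * L ≤ m * volume J := by
    have hJm : Measurable (J.indicator (1 : ℝ → ℝ≥0∞)) := measurable_one.indicator hJ
    calc gaussianReal 0 1 J * ENNReal.ofReal √(2 / π) * L
        = ∫⁻ t, ∫⁻ u, J.indicator 1 (inner ℝ u (γ t)) *
            ENNReal.ofReal |inner ℝ u (deriv γ t)| ∂(stdGaussian E) := by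
          rw [hL, ← lintegral_const_mul _ (by fun_prop)]
          simp_rw [lintegral_indicator_mul_abs_inner_stdGaussian (hnorm _) (horth _) hJ]
      _ = ∫⁻ u, ∫⁻ t, J.indicator 1 (inner ℝ u (γ t)) *
            ENNReal.ofReal |inner ℝ u (deriv γ t)| ∂volume ∂(stdGaussian E) := by
          refine lintegral_lintegral_swap (Measurable.aemeasurable ?_)
          exact (hJm.comp (by fun_prop)).mul (by fun_prop)
      _ ≤ ∫⁻ _, m * volume J ∂(stdGaussian E) := lintegral_mono fun u ↦ hm u J hJ
      _ = m * volume J := by simp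
  have hle (ε : ℝ) (hε : 0 < ε) : L ≤ ENNReal.ofReal (m * π * exp (ε ^ 2 / 2)) := by
    have h := key (Ioo (-ε) ε) measurableSet_Ioo
    rw [Real.volume_Ioo, ← ENNReal.ofReal_natCast, ← ENNReal.ofReal_mul (by positivity)] at h
    have h' := (mul_le_mul_left (mul_le_mul_left (le_gaussianReal_Ioo ε) _) L).trans h
    rw [← ENNReal.ofReal_mul (by positivity)] at h'
    have hpos : 0 < (√(2 * π))⁻¹ * exp (-ε ^ 2 / 2) * (2 * ε) * √(2 / π) := by positivity
    rw [mul_comm,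
      ← ENNReal.le_div_iff_mul_le (.inl (ENNReal.ofReal_pos.2 hpos).ne') (.inl ENNReal.ofReal_ne_top),
      ← ENNReal.ofReal_div_of_pos hpos] at h'
    refine h'.trans_eq (congrArg _ ?_)
    have : √(2 / π) = 2 / √(2 * π) := by
      rw [Real.sqrt_div (by norm_num), Real.sqrt_mul (by norm_num)]
      field_simp
      norm_num
    rw [this, neg_div, Real.exp_neg]
    field_simp
    rw [Real.sq_sqrt (by positivity)]
    ring
  have hlim : Filter.Tendsto (fun ε : ℝ ↦ ENNReal.ofReal (m * π * exp (ε ^ 2 / 2)))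
      (nhdsWithin 0 (Ioi 0)) (nhds (ENNReal.ofReal (m * π))) := by
    have : Continuous fun ε : ℝ ↦ ENNReal.ofReal (m * π * exp (ε ^ 2 / 2)) := 
      ENNReal.continuous_ofReal.comp (by fun_prop)
    simpa using (this.tendsto 0).mono_left nhdsWithin_le_nhds
  exact ge_of_tendsto hlim (eventually_mem_nhdsWithin.mono hle)

/-- Spijker's lemma on the Riemann sphere (Section 3.1.3): if `a, b, c, d` are real
polynomials of degree at most `n` with `a² + b² + c² + d² > 0` everywhere, then the
curve `γ = (f₀,f₁,f₂)/‖(f₀,f₁,f₂)‖` on `S²`, with `f₀ = 2(ac+bd)`, `f₁ = 2(bc-ad)`,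
`f₂ = a²+b²-c²-d²`, has length at most `2nπ`. -/
theorem spijker_lemma (n : ℕ) (a b c d : Polynomial ℝ)
    (ha : a.natDegree ≤ n) (hb : b.natDegree ≤ n)
    (hc : c.natDegree ≤ n) (hd : d.natDegree ≤ n)
    (hpos : ∀ t : ℝ,
      0 < a.eval t ^ 2 + b.eval t ^ 2 + c.eval t ^ 2 + d.eval t ^ 2)
    (F : ℝ → EuclideanSpace ℝ (Fin 3))
    (hF : ∀ t, F t =
      ![2 * (a.eval t * c.eval t + b.eval t * d.eval t),
        2 * (b.eval t * c.eval t - a.eval t * d.eval t),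
        a.eval t ^ 2 + b.eval t ^ 2 - c.eval t ^ 2 - d.eval t ^ 2])
    (γ : ℝ → EuclideanSpace ℝ (Fin 3))
    (hγ : ∀ t, γ t = ‖F t‖⁻¹ • F t) :
    ∫⁻ t : ℝ, ENNReal.ofReal ‖deriv γ t‖ ≤ ENNReal.ofReal (2 * n * π) := by
  let f : Fin 3 → Polynomial ℝ := ![2 * (a * c + b * d), 2 * (b * c - a * d),
    a ^ 2 + b ^ 2 - c ^ 2 - d ^ 2]
  let N : Polynomial ℝ := a ^ 2 + b ^ 2 + c ^ 2 + d ^ 2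
  have hFi (t : ℝ) (i : Fin 3) : F t i = (f i).eval t := by
    rw [hF t]
    fin_cases i <;> simp [f]
  have hNpos (t : ℝ) : 0 < N.eval t := by simpa [N] using hpos t
  have hFN (t : ℝ) : ‖F t‖ = N.eval t := by
    rw [EuclideanSpace.norm_eq, Real.sqrt_eq_iff_mul_self_eq (by positivity) (hNpos t).le]
    simp only [Fin.sum_univ_three, hFi, Real.norm_eq_abs, sq_abs]
    simp [f, N]
    ring
  have hmul {p q : Polynomial ℝ} (hp : p.natDegree ≤ n) (hq : q.natDegree ≤ n) :
      (p * q).natDegree ≤ 2 * n := by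
    have := Polynomial.natDegree_mul_le (p := p) (q := q)
    lia
  have hsq {p : Polynomial ℝ} (hp : p.natDegree ≤ n) : (p ^ 2).natDegree ≤ 2 * n :=
    sq p ▸ hmul hp hp
  have hNdeg : N.natDegree ≤ 2 * n :=
    Polynomial.natDegree_add_le_of_degree_le (Polynomial.natDegree_add_le_of_degree_le
      (Polynomial.natDegree_add_le_of_degree_le (hsq ha) (hsq hb)) (hsq hc)) (hsq hd)
  have htwo {p : Polynomial ℝ} (hp : p.natDegree ≤ 2 * n) : (2 * p).natDegree ≤ 2 * n :=
    (Polynomial.natDegree_C_mul_le 2 p).trans hp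
  have hfdeg (i : Fin 3) : (f i).natDegree ≤ 2 * n := by
    fin_cases i
    · exact htwo (Polynomial.natDegree_add_le_of_degree_le (hmul ha hc) (hmul hb hd))
    · exact htwo (by simpa using Polynomial.natDegree_sub_le_of_le (hmul hb hc) (hmul ha hd))
    · simpa [f] using Polynomial.natDegree_sub_le_of_le (Polynomial.natDegree_sub_le_of_le
        (Polynomial.natDegree_add_le_of_degree_le (hsq ha) (hsq hb)) (hsq hc)) (hsq hd)
  have hFdiff : Differentiable ℝ F := by
    rw [differentiable_euclidean]
    intro i
    simp_rw [hFi]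
    exact (f i).differentiable
  have hγN : γ = fun t ↦ (N.eval t)⁻¹ • F t := by
    ext1 t
    rw [hγ, hFN]
  have hγdiff : Differentiable ℝ γ :=
    hγN ▸ (N.differentiable.inv fun t ↦ (hNpos t).ne').smul hFdiff
  have hnorm (t : ℝ) : ‖γ t‖ = 1 := by
    rw [hγ, norm_smul, norm_inv, norm_norm, hFN, inv_mul_cancel₀ (hNpos t).ne']
  have hlen := lintegral_norm_deriv_le_of_unit hγdiff hnorm (m := 2 * n) fun u J hJ ↦ by
    let P : Polynomial ℝ := ∑ i, Polynomial.C (u i) * f i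
    have hP : P.natDegree ≤ 2 * n :=
      Polynomial.natDegree_sum_le_of_forall_le _ _ fun i _ ↦
        (Polynomial.natDegree_C_mul_le _ _).trans (hfdeg i)
    have hinner : (fun t ↦ inner ℝ u (γ t)) = fun t ↦ P.eval t / N.eval t := by
      ext t
      rw [hγN]
      simp only [inner_smul_right, PiLp.inner_apply, hFi, P, Polynomial.eval_finsetSum,
        Polynomial.eval_mul, Polynomial.eval_C, RCLike.inner_apply, conj_trivial]
      simp_rw [mul_comm (u _), div_eq_inv_mul]
    have hderiv (t : ℝ) :
        inner ℝ u (deriv γ t) = deriv (fun t ↦ P.eval t / N.eval t) t := by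
      rw [← hinner]
      simpa using ((hasDerivAt_const t u).inner ℝ (hγdiff t).hasDerivAt).deriv.symm
    simp_rw [hderiv, fun t ↦ congrFun hinner t]
    exact lintegral_indicator_mul_abs_deriv_div_le hP hNdeg (fun t ↦ (hNpos t).ne') hJ
  simpa using hlen
end
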